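/- For every T ∈ R(V): Weyl(T)^⊥ = (1/(n−2)) ((n−3) T̂^⊥ − ε hat(Ric(T^∥))) = T̂^⊥ − ε hat(Sch(T)^∥), and Weyl(T)^{⊥∥} = T̂^{⊥∥}. -/

import Mathlib

open scoped BigOperators

noncomputable section

namespace Decomp

abbrev Vec (n : ℕ) := Fin n → ℝ
abbrev Ten2 (n : ℕ) := Fin n → Fin n → ℝ
abbrev Ten3 (n : ℕ) := Fin n → Fin n → Fin n → ℝ
abbrev Ten4 (n : ℕ) := Fin n → Fin n → Fin n → Fin n → ℝ

variable {n : ℕ}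

/-- A (0,4)-tensor with the algebraic symmetries of a Riemann tensor. -/
def IsRiemannType (T : Ten4 n) : Prop :=
  (∀ α β μ ν, T α β μ ν = - T α β ν μ) ∧
  (∀ α β μ ν, T α β μ ν = - T β α μ ν) ∧
  (∀ α β μ ν, T α β μ ν = T μ ν α β) ∧
  (∀ α β μ ν, T α β μ ν + T α μ ν β + T α ν β μ = 0)

/-- A (0,3)-tensor antisymmetric in the last two indices with vanishing cyclic sum. -/
def IsLambda12 (F : Ten3 n) : Prop :=
  (∀ α μ ν, F α μ ν = - F α ν μ) ∧
  (∀ α μ ν, F α μ ν + F μ ν α + F ν α μ = 0)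

def IsSym2 (S : Ten2 n) : Prop := ∀ α β, S α β = S β α

/-- Ricci-type trace of a (0,4)-tensor (first and third indices, using the inverse metric). -/
def RicT (ginv : Ten2 n) (T : Ten4 n) : Ten2 n :=
  fun β ν => ∑ α, ∑ μ, ginv α μ * T α β μ ν

/-- Scalar-type trace. -/
def ScalT (ginv : Ten2 n) (T : Ten4 n) : ℝ :=
  ∑ β, ∑ ν, ginv β ν * RicT ginv T β ν

/-- Weyl-type: Riemann-type and trace-free in the first and third indices. -/
def IsWeylType (ginv : Ten2 n) (T : Ten4 n) : Prop :=
  IsRiemannType T ∧ ∀ β ν, RicT ginv T β ν = 0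

/-- Kulkarni–Nomizu product. -/
def KN (A B : Ten2 n) : Ten4 n := fun α β μ ν =>
  A α μ * B β ν - A α ν * B β μ - A β μ * B α ν + A β ν * B α μ

/-- (u ⊛ F) for a one-form w and F ∈ Λ^{(1,2)}. -/
def circ (w : Vec n) (F : Ten3 n) : Ten4 n := fun α β μ ν =>
  w α * F β μ ν - w β * F α μ ν + w μ * F ν α β - w ν * F μ α β

/-- Lower an index with the metric. -/
def lower (g : Ten2 n) (u : Vec n) : Vec n := fun α => ∑ β, g α β * u β

/-- Projector orthogonal to `u`, both indices covariant: γ_{αβ} = g_{αβ} − ε u_α u_β. -/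
def gam (g : Ten2 n) (ε : ℝ) (u : Vec n) : Ten2 n := fun α β =>
  g α β - ε * lower g u α * lower g u β

/-- Mixed projector γ^κ_μ = δ^κ_μ − ε u^κ u_μ. -/
def gamMix (g : Ten2 n) (ε : ℝ) (u : Vec n) : Ten2 n := fun κ μ =>
  (if κ = μ then (1 : ℝ) else 0) - ε * u κ * lower g u μ

/-- Contravariant projector γ^{αβ} = g^{αβ} − ε u^α u^β. -/
def gamUp (ginv : Ten2 n) (ε : ℝ) (u : Vec n) : Ten2 n := fun α β =>
  ginv α β - ε * u α * u β

/-- η := u⊗u − (ε/(n−3)) γ. -/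
def eta (g : Ten2 n) (ε : ℝ) (u : Vec n) : Ten2 n := fun α β =>
  lower g u α * lower g u β - (ε / ((n : ℝ) - 3)) * gam g ε u α β

/-- T^⊥_{βν} := u^α u^μ T_{αβμν}. -/
def perp (u : Vec n) (T : Ten4 n) : Ten2 n := fun β ν =>
  ∑ α, ∑ μ, u α * u μ * T α β μ ν

/-- T^{⊥∥}_{βμν} := u^α γ^κ_μ γ^σ_ν T_{αβκσ}. -/
def perppar (g : Ten2 n) (ε : ℝ) (u : Vec n) (T : Ten4 n) : Ten3 n := fun β μ ν =>
  ∑ α, ∑ κ, ∑ σ, u α * gamMix g ε u κ μ * gamMix g ε u σ ν * T α β κ σ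

/-- T^∥ : projection of T with γ in all four indices. -/
def par4 (g : Ten2 n) (ε : ℝ) (u : Vec n) (T : Ten4 n) : Ten4 n := fun α β μ ν =>
  ∑ ρ, ∑ σ, ∑ κ, ∑ δ,
    gamMix g ε u ρ α * gamMix g ε u σ β * gamMix g ε u κ μ * gamMix g ε u δ ν * T ρ σ κ δ

/-- T^{∥u} := T^∥ + (ε/(n−3)) T^⊥ ∧ γ. -/
def parU (g : Ten2 n) (ε : ℝ) (u : Vec n) (T : Ten4 n) : Ten4 n := fun α β μ ν =>
  par4 g ε u T α β μ ν + (ε / ((n : ℝ) - 3)) * KN (perp u T) (gam g ε u) α β μ ν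

/-- Complete orthogonality to `u` for (0,2)-tensors. -/
def Orth2 (u : Vec n) (S : Ten2 n) : Prop :=
  (∀ β, (∑ α, u α * S α β) = 0) ∧ (∀ β, (∑ α, u α * S β α) = 0)

/-- Complete orthogonality to `u` for (0,3)-tensors. -/
def Orth3 (u : Vec n) (F : Ten3 n) : Prop :=
  (∀ μ ν, (∑ α, u α * F α μ ν) = 0) ∧ (∀ μ ν, (∑ α, u α * F μ α ν) = 0) ∧
    (∀ μ ν, (∑ α, u α * F μ ν α) = 0)

/-- Complete orthogonality to `u` for (0,4)-tensors. -/
def Orth4 (u : Vec n) (T : Ten4 n) : Prop :=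
  (∀ β μ ν, (∑ α, u α * T α β μ ν) = 0) ∧ (∀ β μ ν, (∑ α, u α * T β α μ ν) = 0) ∧
    (∀ β μ ν, (∑ α, u α * T β μ α ν) = 0) ∧ (∀ β μ ν, (∑ α, u α * T β μ ν α) = 0)

/-- tr_γ of a (0,2)-tensor. -/
def trGam (ginv : Ten2 n) (ε : ℝ) (u : Vec n) (S : Ten2 n) : ℝ :=
  ∑ α, ∑ β, gamUp ginv ε u α β * S α β

/-- Schouten-type tensor of a (0,4)-tensor. -/
def SchT (g ginv : Ten2 n) (T : Ten4 n) : Ten2 n := fun β ν =>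
  (1 / ((n : ℝ) - 2)) * (RicT ginv T β ν - ScalT ginv T / (2 * ((n : ℝ) - 1)) * g β ν)

/-- Weyl-type part of a (0,4)-tensor: Weyl(T) := T − Sch(T) ∧ g. -/
def WeylT (g ginv : Ten2 n) (T : Ten4 n) : Ten4 n := fun α β μ ν =>
  T α β μ ν - KN (SchT g ginv T) g α β μ ν

/-- Sch_u for Riemann-type tensors completely orthogonal to u. -/
def SchU (g ginv : Ten2 n) (ε : ℝ) (u : Vec n) (P : Ten4 n) : Ten2 n := fun β ν =>
  (1 / ((n : ℝ) - 3)) * (RicT ginv P β ν - ScalT ginv P / (2 * ((n : ℝ) - 2)) * gam g ε u β ν)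

/-- Weyl_u for Riemann-type tensors completely orthogonal to u. -/
def WeylU (g ginv : Ten2 n) (ε : ℝ) (u : Vec n) (P : Ten4 n) : Ten4 n := fun α β μ ν =>
  P α β μ ν - KN (SchU g ginv ε u P) (gam g ε u) α β μ ν

/-- Z_tr := tr_γ T^⊥. -/
def Ztr (ginv : Ten2 n) (ε : ℝ) (u : Vec n) (T : Ten4 n) : ℝ :=
  trGam ginv ε u (perp u T)

/-- γ-trace-free part of an orthogonal symmetric (0,2)-tensor. -/
def hat2 (g ginv : Ten2 n) (ε : ℝ) (u : Vec n) (S : Ten2 n) : Ten2 n := fun β ν =>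
  S β ν - trGam ginv ε u S / ((n : ℝ) - 1) * gam g ε u β ν

/-- T̂^⊥ := T^⊥ − (Z_tr/(n−1)) γ. -/
def hatPerp (g ginv : Ten2 n) (ε : ℝ) (u : Vec n) (T : Ten4 n) : Ten2 n :=
  hat2 g ginv ε u (perp u T)

/-- (V_tr)_μ := γ^{αβ} T^{⊥∥}_{αβμ}. -/
def Vtr (g ginv : Ten2 n) (ε : ℝ) (u : Vec n) (T : Ten4 n) : Vec n := fun μ =>
  ∑ α, ∑ β, gamUp ginv ε u α β * perppar g ε u T α β μ

/-- T̂^{⊥∥}_{αβμ} := T^{⊥∥}_{αβμ} + (1/(n−2))(−γ_{αβ}(V_tr)_μ + γ_{αμ}(V_tr)_β). -/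
def hatPerppar (g ginv : Ten2 n) (ε : ℝ) (u : Vec n) (T : Ten4 n) : Ten3 n := fun α β μ =>
  perppar g ε u T α β μ + (1 / ((n : ℝ) - 2)) *
    (- gam g ε u α β * Vtr g ginv ε u T μ + gam g ε u α μ * Vtr g ginv ε u T β)

/-- S^∥_{βν} := γ^ρ_β γ^κ_ν S_{ρκ}. -/
def s2par (g : Ten2 n) (ε : ℝ) (u : Vec n) (S : Ten2 n) : Ten2 n := fun β ν =>
  ∑ ρ, ∑ κ, gamMix g ε u ρ β * gamMix g ε u κ ν * S ρ κ

/-- S^{⊥∥}_β := γ^ρ_β u^κ S_{ρκ}. -/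
def s2perppar (g : Ten2 n) (ε : ℝ) (u : Vec n) (S : Ten2 n) : Vec n := fun β =>
  ∑ ρ, ∑ κ, gamMix g ε u ρ β * u κ * S ρ κ

/-- S^⊥ := u^ρ u^κ S_{ρκ}. -/
def s2perp (u : Vec n) (S : Ten2 n) : ℝ := ∑ ρ, ∑ κ, u ρ * u κ * S ρ κ

/-- σ^{(2)}_{βν} := σ_{βρ} σ^ρ{}_ν. -/
def sq (ginv : Ten2 n) (σ : Ten2 n) : Ten2 n := fun β ν =>
  ∑ ρ, ∑ κ, σ β ρ * ginv ρ κ * σ κ ν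

/-- Mixed projector h^μ_{μ'} = γ^μ_{μ'} + ε y^μ y_{μ'} orthogonal to span{u,y}. -/
def hMix (g : Ten2 n) (ε : ℝ) (u y : Vec n) : Ten2 n := fun μ μ' =>
  gamMix g ε u μ μ' + ε * y μ * lower g y μ'

/-- Covariant projector h_{αβ} = γ_{αβ} + ε y_α y_β. -/
def hCov (g : Ten2 n) (ε : ℝ) (u y : Vec n) : Ten2 n := fun α β =>
  gam g ε u α β + ε * lower g y α * lower g y β

/-- g is a symmetric nondegenerate bilinear form with (symmetric) inverse ginv. -/
def GoodMetric (g ginv : Ten2 n) : Prop :=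
  (∀ α β, g α β = g β α) ∧ (∀ α β, ginv α β = ginv β α) ∧
    (∀ α β, (∑ μ, ginv α μ * g μ β) = if α = β then (1 : ℝ) else 0) ∧
    (∀ α β, (∑ μ, g α μ * ginv μ β) = if α = β then (1 : ℝ) else 0)

/-- u is a unit vector with g(u,u) = ε ∈ {−1,1}. -/
def UnitVec (g : Ten2 n) (ε : ℝ) (u : Vec n) : Prop :=
  (ε = 1 ∨ ε = -1) ∧ (∑ α, ∑ β, g α β * u α * u β) = ε

/-- Contraction of a (0,2)-tensor with a contravariant (2,0)-tensor. -/
def contr2 (h S : Ten2 n) : ℝ := ∑ α, ∑ β, h α β * S α β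

lemma contr2_sub (h S S' : Ten2 n) (c : ℝ) :
    contr2 h (fun β ν => S β ν - c * S' β ν) = contr2 h S - c * contr2 h S' := by
  simp only [contr2, Finset.mul_sum, ← Finset.sum_sub_distrib]
  exact Finset.sum_congr rfl fun _ _ => Finset.sum_congr rfl fun _ _ => by ring

lemma contr2_smul (h S : Ten2 n) (c : ℝ) :
    contr2 h (fun β ν => c * S β ν) = c * contr2 h S := by
  simp only [contr2, Finset.mul_sum]
  exact Finset.sum_congr rfl fun _ _ => Finset.sum_congr rfl fun _ _ => by ring

lemma contr2_gamUp (ginv : Ten2 n) (ε : ℝ) (u : Vec n) (S : Ten2 n) :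
    contr2 (gamUp ginv ε u) S = contr2 ginv S - ε * s2perp u S := by
  simp only [contr2, s2perp, gamUp, Finset.mul_sum, ← Finset.sum_sub_distrib]
  exact Finset.sum_congr rfl fun _ _ => Finset.sum_congr rfl fun _ _ => by ring

lemma s2perp_sub (u : Vec n) (S S' : Ten2 n) (c : ℝ) :
    s2perp u (fun β ν => S β ν - c * S' β ν) = s2perp u S - c * s2perp u S' :=
  contr2_sub (fun α β => u α * u β) S S' c

lemma trGam_sub (ginv : Ten2 n) (ε : ℝ) (u : Vec n) (S S' : Ten2 n) (c : ℝ) :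
    trGam ginv ε u (fun β ν => S β ν - c * S' β ν)
      = trGam ginv ε u S - c * trGam ginv ε u S' :=
  contr2_sub (gamUp ginv ε u) S S' c

lemma trGam_smul (ginv : Ten2 n) (ε : ℝ) (u : Vec n) (S : Ten2 n) (c : ℝ) :
    trGam ginv ε u (fun β ν => c * S β ν) = c * trGam ginv ε u S :=
  contr2_smul (gamUp ginv ε u) S c

lemma trGam_eq (ginv : Ten2 n) (ε : ℝ) (u : Vec n) (S : Ten2 n) :
    trGam ginv ε u S = contr2 ginv S - ε * s2perp u S :=
  contr2_gamUp ginv ε u S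

lemma s2perp_eq_left (u : Vec n) (S : Ten2 n) :
    s2perp u S = ∑ ν, u ν * ∑ α, u α * S α ν := by
  rw [s2perp, Finset.sum_comm]
  simp only [Finset.mul_sum]
  exact Finset.sum_congr rfl fun _ _ => Finset.sum_congr rfl fun _ _ => by ring

lemma s2perp_eq_right (u : Vec n) (S : Ten2 n) :
    s2perp u S = ∑ β, u β * ∑ α, u α * S β α := by
  simp only [s2perp, Finset.mul_sum, mul_assoc]

lemma sum_gamMix (g : Ten2 n) (ε : ℝ) (u X : Vec n) (μ : Fin n) :
    ∑ κ, gamMix g ε u κ μ * X κ = X μ - ε * lower g u μ * ∑ κ, u κ * X κ := by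
  simp only [gamMix, sub_mul, Finset.sum_sub_distrib, ite_mul, one_mul, zero_mul,
    Finset.sum_ite_eq', Finset.mem_univ, if_true, Finset.mul_sum]
  exact congrArg _ (Finset.sum_congr rfl fun _ _ => by ring)

lemma UnitVec.sq_eq_one {g : Ten2 n} {ε : ℝ} {u : Vec n} (hu : UnitVec g ε u) :
    ε * ε = 1 := by
  rcases hu.1 with h | h <;> rw [h] <;> norm_num

lemma UnitVec.sum_mul_lower {g : Ten2 n} {ε : ℝ} {u : Vec n} (hu : UnitVec g ε u) :
    ∑ α, u α * lower g u α = ε := by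
  rw [← hu.2]
  simp only [lower, Finset.mul_sum]
  exact Finset.sum_congr rfl fun _ _ => Finset.sum_congr rfl fun _ _ => by ring

lemma GoodMetric.sum_mul_left {g ginv : Ten2 n} (hg : GoodMetric g ginv) (u : Vec n)
    (ν : Fin n) : ∑ α, u α * g α ν = lower g u ν :=
  Finset.sum_congr rfl fun α _ => by rw [hg.1 α ν]; ring

lemma sum_mul_metric_right (g : Ten2 n) (u : Vec n)
    (ν : Fin n) : ∑ α, u α * g ν α = lower g u ν :=
  Finset.sum_congr rfl fun α _ => by ring

lemma GoodMetric.sum_ginv_lower {g ginv : Ten2 n} (hg : GoodMetric g ginv) (u : Vec n)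
    (α : Fin n) : ∑ β, ginv α β * lower g u β = u α := by
  simp only [lower, Finset.mul_sum]
  rw [Finset.sum_comm]
  simp only [← mul_assoc, ← Finset.sum_mul, hg.2.2.1]
  simp

lemma GoodMetric.contr2_lower_left {g ginv : Ten2 n} (hg : GoodMetric g ginv) (u a : Vec n) :
    contr2 ginv (fun β ν => lower g u β * a ν) = ∑ ν, u ν * a ν := by
  rw [contr2, Finset.sum_comm]
  refine Finset.sum_congr rfl fun ν _ => ?_
  rw [← hg.sum_ginv_lower u ν, Finset.sum_mul]
  exact Finset.sum_congr rfl fun β _ => by rw [hg.2.1 β ν]; ring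

lemma GoodMetric.contr2_lower_right {g ginv : Ten2 n} (hg : GoodMetric g ginv) (u a : Vec n) :
    contr2 ginv (fun β ν => a β * lower g u ν) = ∑ ν, u ν * a ν := by
  rw [contr2]
  refine Finset.sum_congr rfl fun ν _ => ?_
  rw [← hg.sum_ginv_lower u ν, Finset.sum_mul]
  exact Finset.sum_congr rfl fun β _ => by ring

lemma GoodMetric.contr2_metric {g ginv : Ten2 n} (hg : GoodMetric g ginv) :
    contr2 ginv g = n := by
  have h : ∀ α, ∑ β, ginv α β * g α β = 1 := fun α => by
    rw [← if_pos (c := α = α) (t := (1 : ℝ)) (e := 0) rfl, ← hg.2.2.1 α α]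
    exact Finset.sum_congr rfl fun β _ => by rw [hg.1 α β]
  simp [contr2, h]

lemma s2par_eq (g : Ten2 n) (ε : ℝ) (u : Vec n) (S : Ten2 n) (β ν : Fin n) :
    s2par g ε u S β ν = S β ν - ε * (lower g u β * ∑ α, u α * S α ν)
      - ε * ((∑ α, u α * S β α) * lower g u ν)
      + ε * ε * s2perp u S * (lower g u β * lower g u ν) := by
  have h : s2par g ε u S β ν
      = ∑ ρ, gamMix g ε u ρ β * ∑ κ, gamMix g ε u κ ν * S ρ κ := by
    simp only [s2par, Finset.mul_sum, mul_assoc]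
  have h2 : ∑ κ, u κ * (S κ ν - ε * lower g u ν * ∑ κ₁, u κ₁ * S κ κ₁)
      = (∑ κ, u κ * S κ ν) - ε * lower g u ν * s2perp u S := by
    rw [s2perp_eq_right, Finset.mul_sum, ← Finset.sum_sub_distrib]
    exact Finset.sum_congr rfl fun _ _ => by ring
  simp only [h, sum_gamMix, h2]
  ring

lemma s2par_sub (g : Ten2 n) (ε : ℝ) (u : Vec n) (S S' : Ten2 n) (c : ℝ) (β ν : Fin n) :
    s2par g ε u (fun β ν => S β ν - c * S' β ν) β ν
      = s2par g ε u S β ν - c * s2par g ε u S' β ν :=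
  contr2_sub (fun ρ κ => gamMix g ε u ρ β * gamMix g ε u κ ν) S S' c

lemma s2par_smul (g : Ten2 n) (ε : ℝ) (u : Vec n) (S : Ten2 n) (c : ℝ) (β ν : Fin n) :
    s2par g ε u (fun β ν => c * S β ν) β ν = c * s2par g ε u S β ν :=
  contr2_smul (fun ρ κ => gamMix g ε u ρ β * gamMix g ε u κ ν) S c

lemma contr2_s2par {g ginv : Ten2 n} (hg : GoodMetric g ginv) {ε : ℝ} {u : Vec n}
    (hu : UnitVec g ε u) (S : Ten2 n) :
    contr2 ginv (s2par g ε u S) = contr2 ginv S - ε * s2perp u S := by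
  have h : s2par g ε u S = fun β ν =>
      ((S β ν - ε * (lower g u β * ∑ α, u α * S α ν))
        - ε * ((∑ α, u α * S β α) * lower g u ν))
      - (-(s2perp u S)) * (lower g u β * lower g u ν) := by
    funext β ν
    rw [s2par_eq, hu.sq_eq_one]
    ring
  rw [h, contr2_sub, contr2_sub, contr2_sub, hg.contr2_lower_left, hg.contr2_lower_right,
    hg.contr2_lower_left, ← s2perp_eq_left, ← s2perp_eq_right, hu.sum_mul_lower]
  ring

lemma s2perp_s2par {g : Ten2 n} {ε : ℝ} {u : Vec n}
    (hu : UnitVec g ε u) (S : Ten2 n) : s2perp u (s2par g ε u S) = 0 := by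
  have h : s2par g ε u S = fun β ν =>
      ((S β ν - ε * (lower g u β * ∑ α, u α * S α ν))
        - ε * ((∑ α, u α * S β α) * lower g u ν))
      - (-(s2perp u S)) * (lower g u β * lower g u ν) := by
    funext β ν
    rw [s2par_eq, hu.sq_eq_one]
    ring
  have hmul : ∀ a b : Vec n, s2perp u (fun β ν => a β * b ν)
      = (∑ β, u β * a β) * ∑ ν, u ν * b ν := fun a b => by
    rw [s2perp, Finset.sum_mul_sum]
    exact Finset.sum_congr rfl fun _ _ => Finset.sum_congr rfl fun _ _ => by ring
  rw [h, s2perp_sub, s2perp_sub, s2perp_sub, hmul, hmul _ (lower g u), hmul,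
    ← s2perp_eq_left, ← s2perp_eq_right, hu.sum_mul_lower]
  linear_combination (-s2perp u S) * hu.sq_eq_one

lemma trGam_s2par {g ginv : Ten2 n} (hg : GoodMetric g ginv) {ε : ℝ} {u : Vec n}
    (hu : UnitVec g ε u) (S : Ten2 n) :
    trGam ginv ε u (s2par g ε u S) = contr2 ginv S - ε * s2perp u S := by
  rw [trGam_eq, contr2_s2par hg hu, s2perp_s2par hu]
  ring

lemma s2perp_metric {g : Ten2 n} {ε : ℝ} {u : Vec n} (hu : UnitVec g ε u) :
    s2perp u g = ε := by
  rw [← hu.2, s2perp]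
  exact Finset.sum_congr rfl fun _ _ => Finset.sum_congr rfl fun _ _ => by ring

lemma s2par_metric {g ginv : Ten2 n} (hg : GoodMetric g ginv) {ε : ℝ} {u : Vec n}
    (hu : UnitVec g ε u) : s2par g ε u g = gam g ε u := by
  funext β ν
  rw [s2par_eq, hg.sum_mul_left, sum_mul_metric_right, s2perp_metric hu, gam]
  linear_combination ε * lower g u β * lower g u ν * hu.sq_eq_one

lemma trGam_gam {g ginv : Ten2 n} (hg : GoodMetric g ginv) {ε : ℝ} {u : Vec n}
    (hu : UnitVec g ε u) : trGam ginv ε u (gam g ε u) = (n : ℝ) - 1 := by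
  rw [← s2par_metric hg hu, trGam_s2par hg hu, hg.contr2_metric, s2perp_metric hu,
    hu.sq_eq_one]

lemma contr2_eq_sum_prod (h S : Ten2 n) :
    contr2 h S = ∑ p : Fin n × Fin n, h p.1 p.2 * S p.1 p.2 :=
  (Fintype.sum_prod_type' fun α β => h α β * S α β).symm

lemma contr2_sum (h : Ten2 n) (c : Vec n) (F : Ten3 n) :
    contr2 h (fun α β => ∑ σ, c σ * F σ α β) = ∑ σ, c σ * contr2 h (F σ) := by
  simp only [contr2_eq_sum_prod, Finset.mul_sum]
  rw [Finset.sum_comm]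
  exact Finset.sum_congr rfl fun _ _ => Finset.sum_congr rfl fun _ _ => by ring

lemma contr2_comm (h k : Ten2 n) (F : Ten4 n) :
    contr2 k (fun σ δ => contr2 h (fun ρ κ => F ρ σ κ δ))
      = contr2 h (fun ρ κ => contr2 k (fun σ δ => F ρ σ κ δ)) := by
  simp only [contr2_eq_sum_prod, Finset.mul_sum]
  rw [Finset.sum_comm]
  exact Finset.sum_congr rfl fun _ _ => Finset.sum_congr rfl fun _ _ => by ring

lemma RicT_par4 {g ginv : Ten2 n} (hg : GoodMetric g ginv) {ε : ℝ} {u : Vec n}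
    (hu : UnitVec g ε u) (T : Ten4 n) (β ν : Fin n) :
    RicT ginv (par4 g ε u T) β ν
      = s2par g ε u (RicT ginv T) β ν - ε * s2par g ε u (perp u T) β ν := by
  have h : ∀ α μ, par4 g ε u T α β μ ν
      = s2par g ε u (fun ρ κ => s2par g ε u (fun σ δ => T ρ σ κ δ) β ν) α μ := fun α μ => by
    simp only [par4, s2par, Finset.mul_sum]
    refine Finset.sum_congr rfl fun ρ _ => ?_
    rw [Finset.sum_comm]
    exact Finset.sum_congr rfl fun _ _ => Finset.sum_congr rfl fun _ _ =>
      Finset.sum_congr rfl fun _ _ => by ring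
  calc RicT ginv (par4 g ε u T) β ν
      = contr2 ginv (s2par g ε u
          (fun ρ κ => s2par g ε u (fun σ δ => T ρ σ κ δ) β ν)) := by
        simp only [RicT, contr2, h]
    _ = _ := by
        rw [contr2_s2par hg hu]
        congr 1
        · exact (contr2_comm ginv (fun ρ κ => gamMix g ε u ρ β * gamMix g ε u κ ν) T).symm
        · exact congrArg _ (contr2_comm (fun α β => u α * u β)
            (fun ρ κ => gamMix g ε u ρ β * gamMix g ε u κ ν) T).symm

lemma IsRiemannType.sum_first_eq_zero {T : Ten4 n} (hT : IsRiemannType T) (u : Vec n)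
    (μ ν : Fin n) : ∑ α, u α * ∑ β, u β * T β α μ ν = 0 := by
  have h : ∑ α, u α * ∑ β, u β * T β α μ ν = - ∑ α, u α * ∑ β, u β * T β α μ ν := by
    simp only [← Finset.sum_neg_distrib, Finset.mul_sum]
    rw [Finset.sum_comm]
    exact Finset.sum_congr rfl fun α _ => Finset.sum_congr rfl fun β _ => by
      rw [hT.2.1 α β]; ring
  linarith

lemma IsRiemannType.pair_swap {T : Ten4 n} (hT : IsRiemannType T) (α β μ ν : Fin n) :
    T α β μ ν = T β α ν μ := by
  rw [hT.1, hT.2.1, neg_neg]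

lemma IsRiemannType.sum_perp_left {T : Ten4 n} (hT : IsRiemannType T) (u : Vec n)
    (ν : Fin n) : ∑ β, u β * perp u T β ν = 0 := by
  have h : ∑ β, u β * perp u T β ν = s2perp u (fun α μ => ∑ β, u β * T α β μ ν) :=
    (contr2_sum (fun α μ => u α * u μ) u (fun β α μ => T α β μ ν)).symm
  rw [h, s2perp_eq_left]
  refine Finset.sum_eq_zero fun μ _ => ?_
  have h' : ∑ α, u α * ∑ β, u β * T α β μ ν = - ∑ α, u α * ∑ β, u β * T β α μ ν := by
    simp only [← Finset.sum_neg_distrib, Finset.mul_sum]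
    exact Finset.sum_congr rfl fun α _ => Finset.sum_congr rfl fun β _ => by
      rw [hT.2.1 α β]; ring
  rw [h', hT.sum_first_eq_zero, neg_zero, mul_zero]

lemma IsRiemannType.perp_symm {T : Ten4 n} (hT : IsRiemannType T) (u : Vec n)
    (β ν : Fin n) : perp u T β ν = perp u T ν β := by
  rw [perp, perp, Finset.sum_comm]
  exact Finset.sum_congr rfl fun α _ => Finset.sum_congr rfl fun μ _ => by
    rw [hT.2.2.1 μ β]; ring

lemma IsRiemannType.s2perp_perp {T : Ten4 n} (hT : IsRiemannType T) (u : Vec n) :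
    s2perp u (perp u T) = 0 := by
  rw [s2perp_eq_left]
  simp [hT.sum_perp_left]

lemma IsRiemannType.s2par_perp {T : Ten4 n} (hT : IsRiemannType T) (g : Ten2 n) (ε : ℝ)
    (u : Vec n) (β ν : Fin n) : s2par g ε u (perp u T) β ν = perp u T β ν := by
  have hr : ∑ α, u α * perp u T β α = 0 := by
    rw [← hT.sum_perp_left u β]
    exact Finset.sum_congr rfl fun α _ => by rw [hT.perp_symm]
  rw [s2par_eq, hT.sum_perp_left, hr, hT.s2perp_perp]
  ring

lemma IsRiemannType.s2perp_RicT {T : Ten4 n} (hT : IsRiemannType T) (ginv : Ten2 n) (ε : ℝ)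
    (u : Vec n) : s2perp u (RicT ginv T) = Ztr ginv ε u T := by
  rw [Ztr, trGam_eq, hT.s2perp_perp, mul_zero, sub_zero]
  refine (contr2_comm ginv (fun α μ => u α * u μ) T).trans ?_
  refine congrArg _ (funext fun α => funext fun μ => ?_)
  exact Finset.sum_congr rfl fun β _ => Finset.sum_congr rfl fun ν _ => by
    rw [hT.pair_swap]

lemma perp_sub (u : Vec n) (T T' : Ten4 n) (β ν : Fin n) :
    perp u (fun α β μ ν => T α β μ ν - T' α β μ ν) β ν = perp u T β ν - perp u T' β ν := by
  simp only [perp, mul_sub, Finset.sum_sub_distrib]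

lemma perp_KN {g ginv : Ten2 n} (hg : GoodMetric g ginv) {ε : ℝ} {u : Vec n}
    (hu : UnitVec g ε u) (S : Ten2 n) (β ν : Fin n) :
    perp u (KN S g) β ν = ε * s2par g ε u S β ν + s2perp u S * gam g ε u β ν := by
  have h : perp u (KN S g) β ν = s2perp u S * g β ν
      - (∑ α, u α * S α ν) * (∑ μ, u μ * g β μ)
      - (∑ α, u α * g α ν) * (∑ μ, u μ * S β μ)
      + s2perp u g * S β ν := by
    rw [Finset.sum_mul_sum, Finset.sum_mul_sum]
    simp only [perp, s2perp, Finset.sum_mul, ← Finset.sum_sub_distrib,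
      ← Finset.sum_add_distrib]
    exact Finset.sum_congr rfl fun _ _ => Finset.sum_congr rfl fun _ _ => by
      simp only [KN]; ring
  rw [h, s2perp_metric hu, hg.sum_mul_left, sum_mul_metric_right, s2par_eq, gam]
  linear_combination (lower g u β * (∑ α, u α * S α ν) + lower g u ν * (∑ μ, u μ * S β μ)
    - ε * s2perp u S * lower g u β * lower g u ν) * hu.sq_eq_one

lemma s2par_mul (g : Ten2 n) (ε : ℝ) (u a b : Vec n) (μ ν : Fin n) :
    s2par g ε u (fun κ σ => a κ * b σ) μ ν
      = (∑ κ, gamMix g ε u κ μ * a κ) * ∑ σ, gamMix g ε u σ ν * b σ := by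
  rw [s2par, Finset.sum_mul_sum]
  exact Finset.sum_congr rfl fun _ _ => Finset.sum_congr rfl fun _ _ => by ring

lemma perppar_eq (g : Ten2 n) (ε : ℝ) (u : Vec n) (T : Ten4 n) (β μ ν : Fin n) :
    perppar g ε u T β μ ν = s2par g ε u (fun κ σ => ∑ α, u α * T α β κ σ) μ ν := by
  refine Eq.trans ?_ (contr2_sum (fun κ σ => gamMix g ε u κ μ * gamMix g ε u σ ν) u
    (fun α κ σ => T α β κ σ)).symm
  simp only [perppar, contr2, Finset.mul_sum, mul_assoc]

lemma perppar_sub (g : Ten2 n) (ε : ℝ) (u : Vec n) (T T' : Ten4 n) (β μ ν : Fin n) :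
    perppar g ε u (fun α β μ ν => T α β μ ν - T' α β μ ν) β μ ν
      = perppar g ε u T β μ ν - perppar g ε u T' β μ ν := by
  simp only [perppar, mul_sub, Finset.sum_sub_distrib]

lemma sum_gamMix_lower {g : Ten2 n} {ε : ℝ} {u : Vec n} (hu : UnitVec g ε u) (μ : Fin n) :
    ∑ κ, gamMix g ε u κ μ * lower g u κ = 0 := by
  rw [sum_gamMix, hu.sum_mul_lower]
  linear_combination (-lower g u μ) * hu.sq_eq_one

lemma sum_gamMix_metric (g : Ten2 n) (ε : ℝ) (u : Vec n) (β μ : Fin n) :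
    ∑ κ, gamMix g ε u κ μ * g β κ = gam g ε u β μ := by
  rw [sum_gamMix, sum_mul_metric_right, gam]
  ring

lemma perppar_KN {g ginv : Ten2 n} (hg : GoodMetric g ginv) {ε : ℝ} {u : Vec n}
    (hu : UnitVec g ε u) (S : Ten2 n) (β μ ν : Fin n) :
    perppar g ε u (KN S g) β μ ν
      = (∑ κ, gamMix g ε u κ μ * ∑ α, u α * S α κ) * gam g ε u β ν
        - (∑ κ, gamMix g ε u κ ν * ∑ α, u α * S α κ) * gam g ε u β μ := by
  have h : (fun κ σ => ∑ α, u α * KN S g α β κ σ) = fun κ σ =>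
      (((∑ α, u α * S α κ) * g β σ - 1 * (g β κ * ∑ α, u α * S α σ))
        - 1 * (S β κ * lower g u σ)) - (-1) * (lower g u κ * S β σ) := by
    funext κ σ
    rw [← hg.sum_mul_left, ← hg.sum_mul_left]
    simp only [Finset.sum_mul, Finset.mul_sum, ← Finset.sum_sub_distrib]
    exact Finset.sum_congr rfl fun _ _ => by simp only [KN]; ring
  rw [perppar_eq, h, s2par_sub, s2par_sub, s2par_sub, s2par_mul, s2par_mul,
    s2par_mul g ε u (S β), s2par_mul g ε u (lower g u), sum_gamMix_lower hu,
    sum_gamMix_lower hu, sum_gamMix_metric, sum_gamMix_metric]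
  ring

lemma contr2_gamUp_mul_lower {g ginv : Ten2 n} (hg : GoodMetric g ginv) {ε : ℝ} {u : Vec n}
    (hu : UnitVec g ε u) (a : Vec n) :
    contr2 (gamUp ginv ε u) (fun α β => a α * lower g u β) = 0 := by
  have h : s2perp u (fun α β => a α * lower g u β) = (∑ α, u α * a α) * ε := by
    rw [← hu.sum_mul_lower, Finset.sum_mul_sum, s2perp]
    exact Finset.sum_congr rfl fun _ _ => Finset.sum_congr rfl fun _ _ => by ring
  rw [contr2_gamUp, hg.contr2_lower_right, h]
  linear_combination (-∑ α, u α * a α) * hu.sq_eq_one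

lemma Vtr_eq {g ginv : Ten2 n} (hg : GoodMetric g ginv) {ε : ℝ} {u : Vec n}
    (hu : UnitVec g ε u) {T : Ten4 n} (hT : IsRiemannType T) (μ : Fin n) :
    Vtr g ginv ε u T μ = - ∑ κ, gamMix g ε u κ μ * ∑ α, u α * RicT ginv T α κ := by
  set D : Ten2 n := fun α κ => ∑ σ, gamMix g ε u σ μ * ∑ l, u l * T l α κ σ with hD
  have hperp : (fun α β => perppar g ε u T α β μ)
      = fun α β => D α β - ε * ((∑ κ, u κ * D α κ) * lower g u β) := by
    funext α β
    have h : perppar g ε u T α β μ = ∑ κ, gamMix g ε u κ β * D α κ := by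
      rw [perppar_eq]
      simp only [s2par, hD, Finset.mul_sum, mul_assoc]
    rw [h, sum_gamMix]
    ring
  have hV : Vtr g ginv ε u T μ
      = contr2 (gamUp ginv ε u) (fun α β => perppar g ε u T α β μ) := rfl
  have hcontr : ∀ h : Ten2 n, contr2 h D
      = ∑ σ, gamMix g ε u σ μ * contr2 h (fun α κ => ∑ l, u l * T l α κ σ) := fun h =>
    contr2_sum h (fun σ => gamMix g ε u σ μ) (fun σ α κ => ∑ l, u l * T l α κ σ)
  have hzero : s2perp u D = 0 := by
    refine (hcontr fun α β => u α * u β).trans (Finset.sum_eq_zero fun σ _ => ?_)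
    have h : s2perp u (fun α κ => ∑ l, u l * T l α κ σ) = 0 := by
      rw [s2perp_eq_left]
      simp [hT.sum_first_eq_zero]
    exact mul_eq_zero_of_right _ h
  have hRic : ∀ l σ, contr2 ginv (fun α κ => T l α κ σ) = - RicT ginv T l σ := fun l σ => by
    simp only [contr2, RicT, ← Finset.sum_neg_distrib]
    exact Finset.sum_congr rfl fun α _ => Finset.sum_congr rfl fun κ _ => by
      rw [hT.2.1 l α]; ring
  rw [hV, hperp, contr2_sub, contr2_gamUp_mul_lower hg hu, contr2_gamUp, hzero, hcontr]
  simp only [contr2_sum ginv u (fun l α κ => T l α κ _), hRic]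
  simp

lemma hat2_sub (g ginv : Ten2 n) (ε : ℝ) (u : Vec n) (S S' : Ten2 n) (c : ℝ) (β ν : Fin n) :
    hat2 g ginv ε u (fun β ν => S β ν - c * S' β ν) β ν
      = hat2 g ginv ε u S β ν - c * hat2 g ginv ε u S' β ν := by
  rw [hat2, hat2, hat2, trGam_sub]
  ring

lemma hat2_smul (g ginv : Ten2 n) (ε : ℝ) (u : Vec n) (S : Ten2 n) (c : ℝ) (β ν : Fin n) :
    hat2 g ginv ε u (fun β ν => c * S β ν) β ν = c * hat2 g ginv ε u S β ν := by
  rw [hat2, hat2, trGam_smul]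
  ring

lemma hat2_gam {g ginv : Ten2 n} (hg : GoodMetric g ginv) {ε : ℝ} {u : Vec n}
    (hu : UnitVec g ε u) (hn : (n : ℝ) - 1 ≠ 0) (β ν : Fin n) :
    hat2 g ginv ε u (gam g ε u) β ν = 0 := by
  rw [hat2, trGam_gam hg hu, div_self hn]
  ring

lemma hat2_s2par_SchT {g ginv : Ten2 n} (hg : GoodMetric g ginv) {ε : ℝ} {u : Vec n}
    (hu : UnitVec g ε u) (hn : (n : ℝ) - 1 ≠ 0) (T : Ten4 n) (β ν : Fin n) :
    hat2 g ginv ε u (s2par g ε u (SchT g ginv T)) β ν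
      = 1 / ((n : ℝ) - 2) * hat2 g ginv ε u (s2par g ε u (RicT ginv T)) β ν := by
  have h : s2par g ε u (SchT g ginv T) = fun β ν => 1 / ((n : ℝ) - 2) *
      (s2par g ε u (RicT ginv T) β ν
        - ScalT ginv T / (2 * ((n : ℝ) - 1)) * gam g ε u β ν) := by
    funext β ν
    unfold SchT
    rw [s2par_smul, s2par_sub, s2par_metric hg hu]
  rw [h, hat2_smul, hat2_sub, hat2_gam hg hu hn]
  ring

lemma perp_WeylT {g ginv : Ten2 n} (hg : GoodMetric g ginv) {ε : ℝ} {u : Vec n}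
    (hu : UnitVec g ε u) (hn1 : (n : ℝ) - 1 ≠ 0) (hn2 : (n : ℝ) - 2 ≠ 0)
    {T : Ten4 n} (hT : IsRiemannType T) (β ν : Fin n) :
    perp u (WeylT g ginv T) β ν = hatPerp g ginv ε u T β ν
      - ε * hat2 g ginv ε u (s2par g ε u (SchT g ginv T)) β ν := by
  have hW : perp u (WeylT g ginv T) β ν
      = perp u T β ν - perp u (KN (SchT g ginv T) g) β ν := perp_sub u T _ β ν
  have hs : s2perp u (SchT g ginv T) = 1 / ((n : ℝ) - 2) *
      (Ztr ginv ε u T - ScalT ginv T / (2 * ((n : ℝ) - 1)) * ε) := by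
    rw [← hT.s2perp_RicT ginv ε u, ← s2perp_metric hu, ← s2perp_sub]
    exact contr2_smul (fun α β => u α * u β) _ _
  have ht : contr2 ginv (SchT g ginv T) = 1 / ((n : ℝ) - 2) *
      (ScalT ginv T - ScalT ginv T / (2 * ((n : ℝ) - 1)) * n) := by
    have hScal : ScalT ginv T = contr2 ginv (RicT ginv T) := rfl
    unfold SchT
    rw [contr2_smul, contr2_sub, hg.contr2_metric, ← hScal]
  have hZ : trGam ginv ε u (perp u T) = Ztr ginv ε u T := rfl
  have key : s2perp u (SchT g ginv T) = Ztr ginv ε u T / ((n : ℝ) - 1)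
      - ε * (contr2 ginv (SchT g ginv T) - ε * s2perp u (SchT g ginv T)) / ((n : ℝ) - 1) := by
    have : ((n : ℝ) - 2) * s2perp u (SchT g ginv T)
        + ε * contr2 ginv (SchT g ginv T) = Ztr ginv ε u T := by
      rw [hs, ht]
      field_simp
      ring
    rw [← this]
    field_simp
    linear_combination (-s2perp u (SchT g ginv T)) * hu.sq_eq_one
  rw [hW, perp_KN hg hu, hatPerp, hat2, hat2, trGam_s2par hg hu, hZ]
  linear_combination (-gam g ε u β ν) * key

/-- identities (r5) and (r7): the `⊥` and `⊥∥` components of `Weyl(T)`. -/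
theorem stmt9 {n : ℕ} (hn : 4 ≤ n) (g ginv : Ten2 n) (hg : GoodMetric g ginv)
    (ε : ℝ) (u : Vec n) (hu : UnitVec g ε u)
    (T : Ten4 n) (hT : IsRiemannType T) :
    (∀ β ν, perp u (WeylT g ginv T) β ν =
        (1 / ((n : ℝ) - 2)) * (((n : ℝ) - 3) * hatPerp g ginv ε u T β ν
          - ε * hat2 g ginv ε u (RicT ginv (par4 g ε u T)) β ν)) ∧
    (∀ β ν, perp u (WeylT g ginv T) β ν =
        hatPerp g ginv ε u T β ν
          - ε * hat2 g ginv ε u (s2par g ε u (SchT g ginv T)) β ν) ∧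
    (∀ β μ ν, perppar g ε u (WeylT g ginv T) β μ ν = hatPerppar g ginv ε u T β μ ν) := by
  have hn' : (4 : ℝ) ≤ n := by exact_mod_cast hn
  have hn1 : (n : ℝ) - 1 ≠ 0 := by linarith
  have hn2 : (n : ℝ) - 2 ≠ 0 := by linarith
  refine ⟨fun β ν => ?_, perp_WeylT hg hu hn1 hn2 hT, fun β μ ν => ?_⟩
  · have hR : RicT ginv (par4 g ε u T) = fun β ν =>
        s2par g ε u (RicT ginv T) β ν - ε * perp u T β ν := by
      funext β ν
      rw [RicT_par4 hg hu, hT.s2par_perp]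
    rw [perp_WeylT hg hu hn1 hn2 hT, hat2_s2par_SchT hg hu hn1, hR, hat2_sub, hatPerp]
    field_simp
    linear_combination (-hat2 g ginv ε u (perp u T) β ν) * hu.sq_eq_one
  · have hW : perppar g ε u (WeylT g ginv T) β μ ν = perppar g ε u T β μ ν
        - perppar g ε u (KN (SchT g ginv T) g) β μ ν := perppar_sub g ε u T _ β μ ν
    have hS : ∀ μ, ∑ κ, gamMix g ε u κ μ * ∑ α, u α * SchT g ginv T α κ
        = - (1 / ((n : ℝ) - 2) * Vtr g ginv ε u T μ) := fun μ => by
      have h : ∀ κ, ∑ α, u α * SchT g ginv T α κ = 1 / ((n : ℝ) - 2) *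
          ((∑ α, u α * RicT ginv T α κ)
            - ScalT ginv T / (2 * ((n : ℝ) - 1)) * lower g u κ) := fun κ => by
        rw [← hg.sum_mul_left]
        simp only [Finset.mul_sum, ← Finset.sum_sub_distrib]
        exact Finset.sum_congr rfl fun _ _ => by simp only [SchT]; ring
      have h' : ∑ κ, gamMix g ε u κ μ * ∑ α, u α * SchT g ginv T α κ
          = 1 / ((n : ℝ) - 2) * ((∑ κ, gamMix g ε u κ μ * ∑ α, u α * RicT ginv T α κ)
            - ScalT ginv T / (2 * ((n : ℝ) - 1))
              * ∑ κ, gamMix g ε u κ μ * lower g u κ) := by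
        simp only [h]
        rw [Finset.mul_sum (a := ScalT ginv T / _), ← Finset.sum_sub_distrib, Finset.mul_sum]
        exact Finset.sum_congr rfl fun _ _ => by ring
      rw [h', sum_gamMix_lower hu, Vtr_eq hg hu hT]
      ring
    rw [hW, perppar_KN hg hu, hS, hS, hatPerppar]
    ring

end Decomp
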